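/- Let p be a prime and M an abelian group with an external Frobenius φ. Then for all i, k ≥ 0 and every m ∈ M^{⊗p^i}, the element φ_{k+i}(m^{⊗p^k}) − m^{⊗p^{k+1}} of M^{⊗p^{k+i+1}} lies in the image of the transfer tr_e^{C_{p^{k+1}}} = Σ_{s=0}^{p^{k+1}−1} σ_{k+i+1}^{s·p^i} : M^{⊗p^{k+i+1}} → M^{⊗p^{k+i+1}} (the norm of the subgroup C_{p^{k+1}} ⊆ C_{p^{k+i+1}} generated by σ_{k+i+1}^{p^i}). -/

import Mathlib

open scoped TensorProduct

section Digits

/-- Identification of digit tuples `(Fin p)^m` (first digit most significant) with `Fin (p^m)`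
via base-`p` digits. -/
def msbEquiv (p m : ℕ) : (Fin m → Fin p) ≃ Fin (p ^ m) :=
  (Equiv.piCongrLeft' (fun _ => Fin p) Fin.revPerm).trans finFunctionFinEquiv

/-- The digit rotation `τ_m : (i_1, …, i_m) ↦ (i_m, i_1, …, i_{m-1})` of digit tuples. -/
def rotPerm (p m : ℕ) [NeZero m] : Equiv.Perm (Fin m → Fin p) :=
  Equiv.piCongrLeft' (fun _ => Fin p) (Equiv.addRight (1 : Fin m))

/-- The permutation of `Fin (p^m)` corresponding to a permutation of digit tuples. -/
def digitPerm (p m : ℕ) (e : Equiv.Perm (Fin m → Fin p)) : Equiv.Perm (Fin (p ^ m)) :=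
  Equiv.permCongr (msbEquiv p m) e

end Digits

noncomputable section Tensor

/-- The `m`-fold tensor power over `ℤ` of an abelian group `A`, indexed by `Fin m`. -/
abbrev Tp (A : Type*) [AddCommGroup A] (m : ℕ) : Type _ := ⨂[ℤ] _ : Fin m, A

/-- The action of a permutation `e` of `Fin m` on the tensor power, by reindexing. -/
def permT (A : Type*) [AddCommGroup A] (m : ℕ) (e : Equiv.Perm (Fin m)) :
    Tp A m ≃ₗ[ℤ] Tp A m :=
  PiTensorProduct.reindex ℤ (fun _ : Fin m => A) e

/-- The cyclic permutation `σ_m` on the tensor power, induced by reindexing along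
`x ↦ x + 1` on `Fin m`, so that `σ(a_1 ⊗ ⋯ ⊗ a_m) = a_m ⊗ a_1 ⊗ ⋯ ⊗ a_{m-1}`. -/
def sigmaT (A : Type*) [AddCommGroup A] (m : ℕ) [NeZero m] : Tp A m ≃ₗ[ℤ] Tp A m :=
  permT A m (Equiv.addRight (1 : Fin m))

/-- The norm (transfer) map `N_m = Σ_{s=0}^{m-1} σ_m^s` on the tensor power. -/
def normT (A : Type*) [AddCommGroup A] (m : ℕ) [NeZero m] : Tp A m → Tp A m :=
  fun x => ∑ s ∈ Finset.range m, (⇑(sigmaT A m))^[s] x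

/-- Identification of tensor powers of equal sizes. -/
def tcast {A : Type*} [AddCommGroup A] {a b : ℕ} (h : a = b) : Tp A a ≃ₗ[ℤ] Tp A b :=
  TensorPower.cast ℤ A h

/-- Flattening of an iterated tensor power: `(A^{⊗N})^{⊗q} ≃ A^{⊗(N·q)}`, grouping
consecutive blocks of length `N`. -/
def flattenE (A : Type*) [AddCommGroup A] (N : ℕ) : (q : ℕ) →
    (⨂[ℤ] _ : Fin q, Tp A N) ≃ₗ[ℤ] Tp A (N * q)
  | 0 => (PiTensorProduct.isEmptyEquiv (Fin 0)).trans
      (PiTensorProduct.isEmptyEquiv (Fin 0)).symm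
  | q + 1 =>
      (TensorPower.mulEquiv (R := ℤ) (M := Tp A N) (n := q) (m := 1)).symm.trans <|
      (TensorProduct.congr (flattenE A N q)
        (PiTensorProduct.subsingletonEquiv (0 : Fin 1))).trans <|
      TensorPower.mulEquiv (R := ℤ) (M := A) (n := N * q) (m := N)

/-- The elementary tensor `c^{⊗B} ∈ A^{⊗(N·B)}` whose `B` consecutive blocks of length `N`
all equal `c ∈ A^{⊗N}`. -/
def tpow {A : Type*} [AddCommGroup A] {N : ℕ} (c : Tp A N) (B : ℕ) : Tp A (N * B) :=
  flattenE A N B (PiTensorProduct.tprod ℤ (fun _ : Fin B => c))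

/-- `c^{⊗B}`, recast to live in `A^{⊗m}` along an identification `N * B = m`. -/
def tpowTo {A : Type*} [AddCommGroup A] {N : ℕ} (c : Tp A N) (B : ℕ) {m : ℕ}
    (h : N * B = m) : Tp A m :=
  tcast (A := A) h (tpow c B)

end Tensor

noncomputable section Frobenius

variable (p : ℕ) [NeZero p] {M : Type*} [AddCommGroup M]

/-- `φ^{⊗q}` : applies an additive map `φ : M → M^{⊗p}` to each of the `q` tensor factors,
the `p` outputs of each application of `φ` occupying a consecutive block of length `p`. -/
def frobT (φ : M →+ Tp M p) (q : ℕ) : Tp M q →ₗ[ℤ] Tp M (p * q) :=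
  (flattenE M p q).toLinearMap ∘ₗ
    PiTensorProduct.map (fun _ : Fin q => φ.toIntLinearMap)

/-- The higher Frobenius `φ_n : M^{⊗p^n} → M^{⊗p^{n+1}}`, the composite of `φ^{⊗p^n}`
(outputs of `φ` in the last base-`p` digit) followed by the action of the digit rotation
`τ_{n+1}`. -/
def higherFrob (φ : M →+ Tp M p) (n : ℕ) : Tp M (p ^ n) →ₗ[ℤ] Tp M (p ^ (n + 1)) :=
  (permT M (p ^ (n + 1)) (digitPerm p (n + 1) (rotPerm p (n + 1)))).toLinearMap ∘ₗ
    (tcast (A := M) (pow_succ' p n).symm).toLinearMap ∘ₗ frobT p φ (p ^ n)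

/-- An external Frobenius on an abelian group `M` (for the prime `p`): an additive map
`φ : M → M^{⊗p}` landing in the `σ_1`-invariants and congruent to `m ↦ m^{⊗p}` modulo the
image of the norm map `N_p = Σ_{s=0}^{p-1} σ_1^s`. -/
structure ExternalFrobenius (M : Type*) [AddCommGroup M] : Type _ where
  toFun : M →+ Tp M p
  fixed : ∀ m : M, sigmaT M p (toFun m) = toFun m
  congr_pow : ∀ m : M,
    toFun m - PiTensorProduct.tprod ℤ (fun _ : Fin p => m) ∈ Set.range (normT M p)

end Frobenius

section Transfer

variable {A W : Type*} [AddCommGroup A]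

/-- The image of `1 + g + ⋯ + g ^ (n - 1)`. -/
def transferRange (g : Module.End ℤ A) (n : ℕ) : Submodule ℤ A :=
  LinearMap.range (∑ j ∈ Finset.range n, g ^ j)

theorem mem_transferRange {g : Module.End ℤ A} {n : ℕ} {x : A} :
    x ∈ transferRange g n ↔ ∃ y, ∑ j ∈ Finset.range n, (g ^ j) y = x := by
  simp [transferRange, LinearMap.sum_apply]

/-- A sum over a union of orbits of length `n` is a transfer. -/
theorem sum_mem_transferRange [DecidableEq W] (S : W → W) (g : Module.End ℤ A) (t : W → A)
    (ht : ∀ w, g (t w) = t (S w)) {n : ℕ} (hn : n ≠ 0) (s : Finset W)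
    (hs : ∀ w ∈ s, S w ∈ s) (hper : ∀ w ∈ s, Function.minimalPeriod S w = n) :
    ∑ w ∈ s, t w ∈ transferRange g n := by
  induction s using Finset.strongInduction with
  | H s ih =>
    obtain rfl | ⟨w, hw⟩ := s.eq_empty_or_nonempty
    · simp
    have hpow : ∀ j w, (g ^ j) (t w) = t (S^[j] w) := by
      intro j
      induction j with
      | zero => simp
      | succ j ihj => intro w; rw [pow_succ, Module.End.mul_apply, ht, ihj]; rfl
    set O : Finset W := (Finset.range n).image fun j => S^[j] w with hO
    have hmem : ∀ j, S^[j] w ∈ s := by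
      intro j
      induction j with
      | zero => simpa
      | succ j ihj => rw [Function.iterate_succ_apply']; exact hs _ ihj
    have hOs : O ⊆ s := by
      intro x hx
      obtain ⟨j, -, rfl⟩ := Finset.mem_image.1 hx
      exact hmem j
    have hall : ∀ j, S^[j] w ∈ O := by
      intro j
      refine Finset.mem_image.2 ⟨j % n, by simpa using Nat.mod_lt _ (Nat.pos_of_ne_zero hn), ?_⟩
      rw [← hper w hw, Function.iterate_mod_minimalPeriod_eq]
    have hinj : Set.InjOn (fun j => S^[j] w) (Finset.range n : Set ℕ) := by
      intro a ha b hb hab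
      simp only [Finset.coe_range, Set.mem_Iio, ← hper w hw] at ha hb
      exact (Function.iterate_eq_iterate_iff_of_lt_minimalPeriod ha hb).1 hab
    rw [← Finset.sum_sdiff hOs]
    refine add_mem (ih _ ?_ ?_ ?_) ?_
    · exact Finset.sdiff_ssubset hOs ⟨w, hall 0⟩
    · intro x hx
      simp only [Finset.mem_sdiff] at hx ⊢
      refine ⟨hs _ hx.1, fun h => hx.2 ?_⟩
      obtain ⟨j, -, hj⟩ := Finset.mem_image.1 h
      have hx' : S^[n] x = x := by
        rw [← hper x hx.1]; exact Function.iterate_minimalPeriod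
      obtain ⟨n, rfl⟩ := Nat.exists_eq_succ_of_ne_zero hn
      rw [← hx', Function.iterate_succ_apply, ← hj]
      simp only [← Function.iterate_add_apply]
      exact hall _
    · intro x hx
      exact hper x (Finset.sdiff_subset hx)
    · rw [hO, Finset.sum_image hinj]
      exact mem_transferRange.2 ⟨t w, by simp [hpow]⟩

/-- If `S` has order dividing `p ^ (k + 1)`, a sum over all of `W` is congruent modulo transfers to
the sum over the fixed points of `S^[p ^ k]`. -/
theorem sum_sub_sum_filter_mem_transferRange [Fintype W] [DecidableEq W] {p : ℕ} (hp : p.Prime)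
    (k : ℕ) (S : W → W) (g : Module.End ℤ A) (t : W → A) (ht : ∀ w, g (t w) = t (S w))
    (hS : ∀ w, S^[p ^ (k + 1)] w = w) :
    ∑ w, t w - ∑ w with S^[p ^ k] w = w, t w ∈ transferRange g (p ^ (k + 1)) := by
  have := Fact.mk hp
  rw [← Finset.sum_filter_add_sum_filter_not Finset.univ (fun w => S^[p ^ k] w = w),
    add_sub_cancel_left]
  refine sum_mem_transferRange S g t ht (pow_ne_zero _ hp.ne_zero) _ ?_ ?_
  · intro w hw
    simp only [Finset.mem_filter, Finset.mem_univ, true_and] at hw ⊢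
    intro h
    have h' := Function.IsPeriodicPt.apply_iterate (f := S) (n := p ^ k) h (p ^ (k + 1) - 1)
    rw [← Function.iterate_succ_apply, Nat.succ_eq_add_one,
      Nat.sub_add_cancel (Nat.one_le_pow _ _ hp.pos), hS] at h'
    exact hw h'
  · intro w hw
    exact Function.minimalPeriod_eq_prime_pow (Finset.mem_filter.1 hw).2 (hS w)

end Transfer

section Cyclic

/-- Cyclic shift of a sequence, applying `c` to the term that wraps around. -/
def cyc {X : Type*} {q : ℕ} [NeZero q] (c : X → X) (v : Fin q → X) : Fin q → X :=
  fun b => if b = 0 then c (v (b - 1)) else v (b - 1)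

theorem comp_cyc {X Y : Type*} {q : ℕ} [NeZero q] {c : X → X} {d : Y → Y} {f : X → Y}
    (h : ∀ x, f (c x) = d (f x)) (v : Fin q → X) : f ∘ cyc c v = cyc d (f ∘ v) := by
  funext b
  simp only [cyc, Function.comp_apply]
  split_ifs <;> simp [h]

theorem iterate_cyc_of_le {X : Type*} {q : ℕ} [NeZero q] (c : X → X) (v : Fin q → X) (s : ℕ)
    (hs : s ≤ q) (b : Fin q) :
    (cyc c)^[s] v b = if b.val < s then c (v (b - Fin.ofNat q s)) else v (b - Fin.ofNat q s) := by
  induction s generalizing b with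
  | zero =>
    simp
  | succ s ih =>
    rw [Function.iterate_succ_apply', cyc, ih (by omega)]
    have e : b - 1 - Fin.ofNat q s = b - Fin.ofNat q (s + 1) := by
      have : Fin.ofNat q (s + 1) = Fin.ofNat q s + 1 := by
        ext; simp [Fin.ofNat, Fin.val_add, Nat.add_mod]
      rw [this]; abel
    rw [e]
    by_cases hb : b = 0
    · subst hb
      have hv : ((0 : Fin q) - 1).val = q - 1 := by
        rw [zero_sub]
        obtain ⟨q, rfl⟩ := Nat.exists_eq_succ_of_ne_zero (NeZero.ne q)
        simp
      rw [if_pos rfl, if_neg (by omega), if_pos (by simp)]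
    · have hv : (b - 1).val = b.val - 1 := by
        obtain ⟨q, rfl⟩ := Nat.exists_eq_succ_of_ne_zero (NeZero.ne q)
        exact Fin.val_sub_one_of_ne_zero hb
      have hb' : b.val ≠ 0 := fun h => hb (Fin.ext (by simpa using h))
      rw [if_neg hb, hv]
      congr 1
      simp only [eq_iff_iff]; omega

theorem iterate_cyc {X : Type*} {q : ℕ} [NeZero q] (c : X → X) (v : Fin q → X) :
    (cyc c)^[q] v = c ∘ v := by
  funext b
  have : Fin.ofNat q q = 0 := by ext; simp
  rw [iterate_cyc_of_le c v q le_rfl, if_pos b.isLt, this, sub_zero]; rfl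

theorem cyc_id_eq_self_iff {X : Type*} {q : ℕ} [NeZero q] (v : Fin q → X) :
    cyc id v = v ↔ ∀ b, v b = v 0 := by
  constructor
  · intro h b
    have h' : ∀ b : Fin q, v (b - 1) = v b := fun b => by
      conv_rhs => rw [← h]
      simp [cyc]
    obtain ⟨q, rfl⟩ := Nat.exists_eq_succ_of_ne_zero (NeZero.ne q)
    induction b using Fin.induction with
    | zero => rfl
    | succ j ih => rw [← ih, ← h' j.succ]; congr 1; simp [sub_eq_iff_eq_add]
  · intro h
    funext b
    simp [cyc, h b, h (b - 1)]

end Cyclic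

section Words

variable {T U : Type*} [AddCommGroup T] [AddCommGroup U] {q p : ℕ}

/-- The successor map on `Option (Fin p)`, fixing `none`. -/
def optSucc (p : ℕ) [NeZero p] : Option (Fin p) → Option (Fin p) := Option.map (· + 1)

theorem iterate_optSucc (p : ℕ) [NeZero p] (o : Option (Fin p)) : (optSucc p)^[p] o = o := by
  have h : ∀ n (x : Fin p), (optSucc p)^[n] (some x) = some (x + Fin.ofNat p n) := by
    intro n
    induction n with
    | zero => simp
    | succ n ih =>
      intro x
      have : Fin.ofNat p (n + 1) = 1 + Fin.ofNat p n := by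
        ext; simp [Fin.ofNat, Fin.val_add, Nat.add_mod, Nat.add_comm]
      rw [Function.iterate_succ_apply, this, ← add_assoc, ← ih]; rfl
  cases o with
  | none => exact Function.iterate_fixed rfl p
  | some x =>
    have : Fin.ofNat p p = 0 := by ext; simp
    rw [h, this, add_zero]

theorem optSucc_eq_self_iff (hp : p.Prime) [NeZero p] (o : Option (Fin p)) :
    optSucc p o = o ↔ o = none := by
  obtain ⟨p, rfl⟩ := Nat.exists_eq_add_of_le' hp.two_le
  cases o <;> simp [optSucc]

/-- The values `u, y, ρ y, …, ρ ^ (p - 1) y` indexed by `Option (Fin p)`. -/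
def optVal (ρ : Module.End ℤ T) (u y : T) : Option (Fin p) → T
  | none => u
  | some s => (ρ ^ s.val) y

theorem optVal_optSucc [NeZero p] {ρ : Module.End ℤ T} (hρ : ρ ^ p = 1) {u : T} (hu : ρ u = u)
    (y : T) (o : Option (Fin p)) : optVal ρ u y (optSucc p o) = ρ (optVal ρ u y o) := by
  cases o with
  | none => exact hu.symm
  | some s =>
    change (ρ ^ (s + 1).val) y = ρ ((ρ ^ s.val) y)
    have : (s + 1).val = (s.val + 1) % p := by simp [Fin.val_add]
    rw [this, ← pow_eq_pow_mod _ hρ, pow_succ']; rfl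

/-- If `S ^ (p ^ k)` rotates every letter, then replacing `u` by its perturbation by norms changes
the value of a compatible multilinear map by a transfer. -/
theorem map_sub_map_mem_transferRange [NeZero p] (hp : p.Prime) (k : ℕ)
    (L : MultilinearMap ℤ (fun _ : Fin q => T) U) (g : Module.End ℤ U) (ρ : Module.End ℤ T)
    (S : (Fin q → Option (Fin p)) → Fin q → Option (Fin p))
    (hS : ∀ w, S^[p ^ k] w = optSucc p ∘ w) (u v y : Fin q → T)
    (hv : ∀ b, v b = u b + ∑ s ∈ Finset.range p, (ρ ^ s) (y b))
    (hg : ∀ w, g (L fun b => optVal ρ (u b) (y b) (w b)) =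
      L fun b => optVal ρ (u b) (y b) (S w b)) :
    L v - L u ∈ transferRange g (p ^ (k + 1)) := by
  have hS' : ∀ w, S^[p ^ (k + 1)] w = w := by
    have h : ∀ n w, (S^[p ^ k])^[n] w = (optSucc p)^[n] ∘ w := by
      intro n
      induction n with
      | zero => intro w; rfl
      | succ n ih => intro w; rw [Function.iterate_succ_apply, hS, ih]; rfl
    intro w
    rw [pow_succ, Function.iterate_mul, h]
    exact funext fun b => iterate_optSucc p _
  have key := sum_sub_sum_filter_mem_transferRange hp k S g
    (fun w => L fun b => optVal ρ (u b) (y b) (w b)) hg hS'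
  have hfix : (Finset.univ.filter fun w => S^[p ^ k] w = w) =
      ({fun _ => none} : Finset (Fin q → Option (Fin p))) := by
    ext w
    simp [hS, funext_iff, optSucc_eq_self_iff hp]
  rw [hfix, Finset.sum_singleton, ← MultilinearMap.map_sum L] at key
  have hv' : v = fun b => ∑ o : Option (Fin p), optVal ρ (u b) (y b) o := by
    funext b
    rw [hv b, Fintype.sum_option, ← Fin.sum_univ_eq_sum_range (fun s => (ρ ^ s) (y b))]
    rfl
  rwa [hv']

end Words

section Interleave

/-- The bijection sending `b` and `r = d * N + c` to `d * (q * N) + b * N + c`. -/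
def interleave {N q D R J : ℕ} (hR : D * N = R) (hJ : D * (q * N) = J) :
    Fin q × Fin R ≃ Fin J :=
  ((Equiv.refl (Fin q)).prodCongr ((finCongr hR.symm).trans finProdFinEquiv.symm)).trans <|
    (Equiv.prodAssoc (Fin q) (Fin D) (Fin N)).symm.trans <|
      ((Equiv.prodComm (Fin q) (Fin D)).prodCongr (Equiv.refl (Fin N))).trans <|
        (Equiv.prodAssoc (Fin D) (Fin q) (Fin N)).trans <|
          ((Equiv.refl (Fin D)).prodCongr finProdFinEquiv).trans <|
            finProdFinEquiv.trans (finCongr hJ)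

theorem interleave_val {N q D R J : ℕ} (hR : D * N = R) (hJ : D * (q * N) = J) (b : Fin q)
    (r : Fin R) : (interleave hR hJ (b, r)).val = r % N + N * b + q * N * (r / N) := by
  simp [interleave]

theorem interleave_sub {N q D R J : ℕ} [NeZero q] [NeZero R] [NeZero J] (hR : D * N = R)
    (hJ : D * (q * N) = J) (b : Fin q) (r : Fin R) :
    interleave hR hJ (b, r) - Fin.ofNat J N =
      interleave hR hJ (b - 1, if b = 0 then r - Fin.ofNat R N else r) := by
  have hN : 0 < N := Nat.pos_of_ne_zero fun h => NeZero.ne R (by rw [← hR, h, mul_zero])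
  rw [sub_eq_iff_eq_add]
  ext
  rw [Fin.val_add, interleave_val, interleave_val, Fin.val_ofNat, Nat.add_mod_mod]
  have hlt := (interleave hR hJ (b, r)).isLt
  rw [interleave_val] at hlt
  by_cases hb : b = 0
  · subst hb
    have hv : ((0 : Fin q) - 1).val = q - 1 := by
      rw [zero_sub]
      obtain ⟨q, rfl⟩ := Nat.exists_eq_succ_of_ne_zero (NeZero.ne q)
      simp
    obtain ⟨r', rfl⟩ : ∃ r', r = r' + Fin.ofNat R N := ⟨r - Fin.ofNat R N, by simp⟩
    rw [if_pos rfl, add_sub_cancel_right, hv]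
    rw [Fin.val_add, Fin.val_ofNat, Nat.add_mod_mod] at hlt ⊢
    have hr := r'.isLt
    generalize r'.val = x at *
    obtain ⟨c, d, hc, rfl⟩ : ∃ c d, c < N ∧ x = c + N * d :=
      ⟨x % N, x / N, Nat.mod_lt _ hN, (Nat.mod_add_div x N).symm⟩
    obtain ⟨q, rfl⟩ := Nat.exists_eq_succ_of_ne_zero (NeZero.ne q)
    have hd : d < D := by
      by_contra! h
      have := Nat.mul_le_mul_left N h
      rw [mul_comm N D, hR] at this
      omega
    simp only [Fin.val_zero, mul_zero, add_zero, Nat.succ_eq_add_one, Nat.add_sub_cancel,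
      Nat.add_mul_mod_self_left, Nat.mod_eq_of_lt hc, Nat.add_mul_div_left _ _ hN,
      Nat.div_eq_of_lt hc, zero_add] at hlt ⊢
    have hsum : c + N * d + N = c + N * (d + 1) := by ring
    have hsum' : c + N * q + (q + 1) * N * d + N = c + (q + 1) * N * (d + 1) := by ring
    rw [hsum] at hlt ⊢
    rw [hsum']
    rcases Nat.lt_or_ge (d + 1) D with h | h
    · have h1 : c + N * (d + 1) < R := by
        rw [← hR]; nlinarith
      rw [Nat.mod_eq_of_lt h1] at hlt ⊢
      simp only [Nat.add_mul_mod_self_left, Nat.mod_eq_of_lt hc, Nat.add_mul_div_left _ _ hN,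
        Nat.div_eq_of_lt hc, zero_add] at hlt ⊢
      rw [Nat.mod_eq_of_lt hlt]
    · obtain rfl : d + 1 = D := by omega
      have h1 : c + N * (d + 1) = c + R := by rw [← hR, mul_comm]
      have h2 : c + (q + 1) * N * (d + 1) = c + J := by
        rw [← hJ]; simp only [Nat.succ_eq_add_one]; ring
      have h3 : c < R := by rw [← hR]; nlinarith
      have h4 : c < J := by
        rw [← hJ]; nlinarith [Nat.zero_le (q * N), Nat.zero_le (d * ((q + 1) * N))]
      rw [h1, h2, Nat.add_mod_right, Nat.add_mod_right, Nat.mod_eq_of_lt h3, Nat.mod_eq_of_lt h4,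
        Nat.mod_eq_of_lt hc, Nat.div_eq_of_lt hc]
      simp
  · have hv : (b - 1).val = b.val - 1 := by
      obtain ⟨q, rfl⟩ := Nat.exists_eq_succ_of_ne_zero (NeZero.ne q)
      exact Fin.val_sub_one_of_ne_zero hb
    obtain ⟨b', hb'⟩ := Nat.exists_eq_succ_of_ne_zero fun h : b.val = 0 =>
      hb (Fin.ext (by simpa using h))
    rw [if_neg hb, hv]
    rw [hb'] at hlt ⊢
    rw [Nat.succ_eq_add_one] at hlt ⊢
    have : r.val % N + N * (b' + 1 - 1) + q * N * (r / N) + N =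
        r.val % N + N * (b' + 1) + q * N * (r / N) := by
      rw [Nat.add_sub_cancel]; ring
    rw [this, Nat.mod_eq_of_lt hlt]

end Interleave

section Nest

variable {M : Type*} [AddCommGroup M]

theorem MultilinearMap.ext_tprod {ι U : Type*} [Finite ι] {κ : ι → Type*} [AddCommGroup U]
    {f g : MultilinearMap ℤ (fun i : ι => ⨂[ℤ] _ : κ i, M) U}
    (h : ∀ v : (i : ι) → κ i → M, f (fun i => PiTensorProduct.tprod ℤ (v i)) =
      g fun i => PiTensorProduct.tprod ℤ (v i)) : f = g := by
  classical
  have := Fintype.ofFinite ι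
  have key : ∀ s : Finset ι, ∀ w : (i : ι) → ⨂[ℤ] _ : κ i, M,
      (∀ i ∉ s, ∃ v : κ i → M, w i = PiTensorProduct.tprod ℤ v) → f w = g w := by
    intro s
    induction s using Finset.induction_on with
    | empty =>
      intro w hw
      choose v hv using fun i => hw i (by simp)
      rw [show w = fun i => PiTensorProduct.tprod ℤ (v i) from funext hv]
      exact h v
    | insert i s his ih =>
      intro w hw
      rw [← Function.update_eq_self i w]
      induction w i using PiTensorProduct.induction_on with
      | smul_tprod r v =>
        rw [f.map_update_smul, g.map_update_smul, ih]
        intro j hj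
        obtain rfl | hji := eq_or_ne j i
        · exact ⟨v, by simp⟩
        · rw [Function.update_of_ne hji]
          exact hw j (by simp [hji, hj])
      | add x y hx hy => rw [f.map_update_add, g.map_update_add, hx, hy]
  ext w
  exact key Finset.univ w (by simp)

theorem flattenE_tprod (N q : ℕ) (v : Fin q → Fin N → M) :
    flattenE M N q (PiTensorProduct.tprod ℤ fun b => PiTensorProduct.tprod ℤ (v b)) =
      PiTensorProduct.tprod ℤ fun x : Fin (N * q) =>
        v (finProdFinEquiv.symm (finCongr (mul_comm N q) x)).1
          (finProdFinEquiv.symm (finCongr (mul_comm N q) x)).2 := by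
  induction q with
  | zero =>
    simp only [flattenE, LinearEquiv.trans_apply, PiTensorProduct.isEmptyEquiv_apply_tprod]
    rw [LinearEquiv.symm_apply_eq, PiTensorProduct.isEmptyEquiv_apply_tprod]
  | succ q ih =>
    have h : (TensorPower.mulEquiv (R := ℤ) (M := Tp M N) (n := q) (m := 1)).symm
        (PiTensorProduct.tprod ℤ fun b => PiTensorProduct.tprod ℤ (v b)) =
        (PiTensorProduct.tprod ℤ fun b : Fin q => PiTensorProduct.tprod ℤ (v b.castSucc)) ⊗ₜ[ℤ]
          (PiTensorProduct.tprod ℤ fun _ : Fin 1 => PiTensorProduct.tprod ℤ (v (Fin.last q))) := by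
      rw [LinearEquiv.symm_apply_eq, ← TensorPower.gMul_def, TensorPower.tprod_mul_tprod]
      congr 1
      funext b
      refine Fin.lastCases ?_ (fun b => ?_) b
      · exact (Fin.append_right (fun b : Fin q => PiTensorProduct.tprod ℤ (v b.castSucc))
          (fun _ : Fin 1 => PiTensorProduct.tprod ℤ (v (Fin.last q))) 0).symm
      · exact (Fin.append_left (fun b : Fin q => PiTensorProduct.tprod ℤ (v b.castSucc))
          (fun _ : Fin 1 => PiTensorProduct.tprod ℤ (v (Fin.last q))) b).symm
    rw [flattenE, LinearEquiv.trans_apply, LinearEquiv.trans_apply, h, TensorProduct.congr_tmul,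
      ih, PiTensorProduct.subsingletonEquiv_apply_tprod, ← TensorPower.gMul_def,
      TensorPower.tprod_mul_tprod]
    congr 1
    funext x
    refine Fin.addCases (fun x => ?_) (fun x => ?_) x
    · rw [Fin.append_left]
      rfl
    · rw [Fin.append_right]
      have hx : finCongr (mul_comm N (q + 1)) (Fin.natAdd (N * q) x) =
          finProdFinEquiv (Fin.last q, x) := by
        ext; simp [add_comm]
      change _ = v
        (finProdFinEquiv.symm (finCongr (mul_comm N (q + 1)) (Fin.natAdd (N * q) x))).1
        (finProdFinEquiv.symm (finCongr (mul_comm N (q + 1)) (Fin.natAdd (N * q) x))).2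
      rw [hx, Equiv.symm_apply_apply]

/-- The multilinear concatenation of `q` tensors of length `R`, positioned according to `e`. -/
noncomputable def nest (M : Type*) [AddCommGroup M] {q R J : ℕ} (e : Fin q × Fin R ≃ Fin J) :
    MultilinearMap ℤ (fun _ : Fin q => Tp M R) (Tp M J) :=
  ((PiTensorProduct.reindex ℤ (fun _ => M)
    ((finCongr (mul_comm R q)).trans (finProdFinEquiv.symm.trans e))).toLinearMap ∘ₗ
      (flattenE M R q).toLinearMap).compMultilinearMap (PiTensorProduct.tprod ℤ)

theorem nest_tprod {q R J : ℕ} (e : Fin q × Fin R ≃ Fin J) (v : Fin q → Fin R → M) :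
    nest M e (fun b => PiTensorProduct.tprod ℤ (v b)) =
      PiTensorProduct.tprod ℤ fun x => v (e.symm x).1 (e.symm x).2 := by
  simp only [nest, LinearMap.compMultilinearMap_apply, LinearMap.comp_apply,
    LinearEquiv.coe_coe, flattenE_tprod]
  refine (PiTensorProduct.reindex_tprod _ _).trans ?_
  congr 1
  funext x
  simp

theorem nest_nest {q q' q'' R R' J : ℕ} (e : Fin q × Fin R ≃ Fin J) (e' : Fin q' × Fin R' ≃ Fin R)
    (e'' : Fin q'' × Fin R' ≃ Fin J) (g : Fin q × Fin q' ≃ Fin q'')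
    (h : ∀ b b' c, e'' (g (b, b'), c) = e (b, e' (b', c))) (v : Fin q'' → Tp M R') :
    nest M e (fun b => nest M e' fun b' => v (g (b, b'))) = nest M e'' v := by
  let g' : (Σ _ : Fin q, Fin q') ≃ Fin q'' := (Equiv.sigmaEquivProd _ _).trans g
  have key : (nest M e).compMultilinearMap (fun _ => nest M e') =
      (nest M e'').domDomCongr g'.symm := by
    refine MultilinearMap.ext_tprod fun v => ?_
    refine (congrArg (nest M e) (funext fun b => nest_tprod e' fun b' => v ⟨b, b'⟩)).trans
      ((nest_tprod e _).trans (Eq.trans ?_ (nest_tprod e'' fun x => v (g'.symm x)).symm))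
    congr 1
    funext x
    obtain ⟨⟨x, c⟩, rfl⟩ := e''.surjective x
    obtain ⟨⟨b, b'⟩, rfl⟩ := g.surjective x
    simp only [Equiv.symm_apply_apply]
    simp [g', h]
  exact (congrArg (fun f => f fun x => v (g' x)) key).trans
    (congrArg (nest M e'') (funext fun x => congrArg v (g'.apply_symm_apply x)))

theorem permT_tprod {n : ℕ} (e : Equiv.Perm (Fin n)) (v : Fin n → M) :
    permT M n e (PiTensorProduct.tprod ℤ v) = PiTensorProduct.tprod ℤ fun x => v (e.symm x) :=
  PiTensorProduct.reindex_tprod _ _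

/-- The cyclic permutation as an endomorphism. -/
noncomputable def sigmaEnd (M : Type*) [AddCommGroup M] (n : ℕ) [NeZero n] :
    Module.End ℤ (Tp M n) := (sigmaT M n).toLinearMap

theorem sigmaEnd_pow_tprod {n : ℕ} [NeZero n] (s : ℕ) (v : Fin n → M) :
    (sigmaEnd M n ^ s) (PiTensorProduct.tprod ℤ v) =
      PiTensorProduct.tprod ℤ fun x => v (x - Fin.ofNat n s) := by
  induction s generalizing v with
  | zero => simp
  | succ s ih =>
    have h : sigmaEnd M n (PiTensorProduct.tprod ℤ v) =
        PiTensorProduct.tprod ℤ fun x => v (x - 1) := by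
      refine (permT_tprod _ _).trans ?_
      simp [sub_eq_add_neg]
    rw [pow_succ, Module.End.mul_apply, h, ih]
    have : Fin.ofNat n (s + 1) = Fin.ofNat n s + 1 := by
      ext; simp [Fin.ofNat, Fin.val_add, Nat.add_mod]
    simp only [this, sub_sub]

theorem sigmaEnd_pow_self (n : ℕ) [NeZero n] : sigmaEnd M n ^ n = 1 := by
  refine PiTensorProduct.ext (MultilinearMap.ext fun v => ?_)
  simp [sigmaEnd_pow_tprod]

theorem sigmaEnd_pow_iterate {n : ℕ} [NeZero n] (s : ℕ) (x : Tp M n) :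
    (sigmaEnd M n ^ s) x = (⇑(sigmaT M n))^[s] x := by
  rw [Module.End.pow_apply]; rfl

theorem sigmaEnd_pow_nest {N q D R J : ℕ} [NeZero q] [NeZero R] [NeZero J] (hR : D * N = R)
    (hJ : D * (q * N) = J) (w : Fin q → Tp M R) :
    (sigmaEnd M J ^ N) (nest M (interleave hR hJ) w) =
      nest M (interleave hR hJ) (cyc (⇑(sigmaEnd M R ^ N)) w) := by
  have hcyc : ∀ w : Fin q → Tp M R, cyc (⇑(sigmaEnd M R ^ N)) w =
      fun b => (if b = 0 then sigmaEnd M R ^ N else LinearMap.id) (w (b - 1)) := by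
    intro w; funext b; simp only [cyc]; split_ifs <;> rfl
  have key : (sigmaEnd M J ^ N).compMultilinearMap (nest M (interleave hR hJ)) =
      ((nest M (interleave hR hJ)).compLinearMap fun b =>
        if b = 0 then sigmaEnd M R ^ N else LinearMap.id).domDomCongr (Equiv.subRight 1) := by
    refine MultilinearMap.ext_tprod fun v => ?_
    have hb : (fun b : Fin q => (if b = 0 then sigmaEnd M R ^ N else LinearMap.id)
        (PiTensorProduct.tprod ℤ (v (b - 1)))) = fun b => PiTensorProduct.tprod ℤ fun x =>
          if b = 0 then v (b - 1) (x - Fin.ofNat R N) else v (b - 1) x := by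
      funext b
      split_ifs
      · rw [sigmaEnd_pow_tprod]
      · rfl
    rw [MultilinearMap.domDomCongr_apply, MultilinearMap.compLinearMap_apply,
      LinearMap.compMultilinearMap_apply]
    simp only [Equiv.subRight_apply]
    rw [hb, nest_tprod, nest_tprod, sigmaEnd_pow_tprod]
    congr 1
    funext x
    obtain ⟨⟨b, r⟩, rfl⟩ := (interleave hR hJ).surjective x
    rw [Equiv.symm_apply_apply]
    rw [interleave_sub, Equiv.symm_apply_apply]
    simp only
    split_ifs <;> rfl
  rw [hcyc]
  exact congrArg (fun f => f w) key

theorem tpowTo_eq_nest {N B J : ℕ} (m : Tp M N) (h : N * B = J) :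
    tpowTo m B h = nest M (interleave (q := B) (D := 1) (one_mul N)
      (by rw [one_mul, mul_comm, h])) fun _ => m := by
  refine congrArg (fun e => PiTensorProduct.reindex ℤ (fun _ => M) e (tpow m B))
    (Equiv.ext fun x => Fin.ext ?_)
  obtain ⟨⟨b, r⟩, hx⟩ := finProdFinEquiv.surjective (finCongr (mul_comm N B) x)
  simp only [Equiv.trans_apply, ← hx, Equiv.symm_apply_apply, interleave_val]
  have := congrArg Fin.val hx
  simp at this
  simp [← this, Nat.mod_eq_of_lt r.isLt, Nat.div_eq_of_lt r.isLt]

end Nest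

section HigherFrob

variable {M : Type*} [AddCommGroup M]

theorem digitPerm_rotPerm_val (p n : ℕ) (j : Fin (p ^ n)) (d : Fin p) (x : Fin (p ^ (n + 1)))
    (hx : x.val = p * j + d) :
    (digitPerm p (n + 1) (rotPerm p (n + 1)) x).val = j + p ^ n * d := by
  obtain ⟨f, rfl⟩ := (msbEquiv p (n + 1)).surjective x
  have hval : ∀ f : Fin (n + 1) → Fin p, (msbEquiv p (n + 1) f).val =
      ∑ i : Fin (n + 1), (f i.rev).val * p ^ i.val := by
    intro f
    simp [msbEquiv]
  have hrot : ∀ i : Fin (n + 1), rotPerm p (n + 1) f i = f (i - 1) := by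
    intro i
    simp [rotPerm, sub_eq_add_neg]
  have hA : (msbEquiv p (n + 1) f).val = (f (Fin.last n)).val +
      p * ∑ i : Fin n, (f i.succ.rev).val * p ^ i.val := by
    rw [hval, Fin.sum_univ_succ, Finset.mul_sum]
    simp [pow_succ', mul_left_comm]
  have hB : (msbEquiv p (n + 1) (rotPerm p (n + 1) f)).val =
      ∑ i : Fin n, (f i.succ.rev).val * p ^ i.val + p ^ n * (f (Fin.last n)).val := by
    rw [hval, Fin.sum_univ_castSucc]
    congr 1
    · refine Finset.sum_congr rfl fun i _ => ?_
      rw [hrot, Fin.rev_castSucc, Fin.rev_succ]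
      rw [← Fin.coeSucc_eq_succ, add_sub_cancel_right]
      rfl
    · rw [hrot]
      have : (Fin.last n).rev - 1 = Fin.last n := by
        rw [sub_eq_iff_eq_add, Fin.rev_last, Fin.last_add_one]
      rw [this, Fin.val_last, mul_comm]
  rw [digitPerm, Equiv.permCongr_apply, Equiv.symm_apply_apply, hB]
  rw [hA, add_comm] at hx
  have hp : 0 < p := d.pos
  have hd : (f (Fin.last n)).val = d := by
    simpa [Nat.mul_add_mod, Nat.mod_eq_of_lt] using congrArg (· % p) hx
  rw [hd] at hx ⊢
  rw [Nat.eq_of_mul_eq_mul_left hp (Nat.add_right_cancel hx)]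

theorem higherFrob_tprod (p : ℕ) [NeZero p] (φ : M →+ Tp M p) (n : ℕ) (v : Fin (p ^ n) → M) :
    higherFrob p φ n (PiTensorProduct.tprod ℤ v) =
      nest M (interleave (N := 1) (mul_one p) (by rw [mul_one, pow_succ'])) fun b => φ (v b) := by
  have h : frobT p φ (p ^ n) (PiTensorProduct.tprod ℤ v) =
      flattenE M p (p ^ n) (PiTensorProduct.tprod ℤ fun b => φ (v b)) :=
    congrArg (flattenE M p (p ^ n)) (PiTensorProduct.map_tprod _ _)
  simp only [higherFrob, LinearMap.comp_apply, h]
  refine (PiTensorProduct.reindex_reindex _ _ _).trans ?_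
  refine congrArg (fun e => PiTensorProduct.reindex ℤ (fun _ => M) e
    (flattenE M p (p ^ n) (PiTensorProduct.tprod ℤ fun b => φ (v b))))
    (Equiv.ext fun x => Fin.ext ?_)
  obtain ⟨⟨b, r⟩, hx⟩ := finProdFinEquiv.surjective (finCongr (mul_comm p (p ^ n)) x)
  simp only [Equiv.trans_apply, ← hx, Equiv.symm_apply_apply, interleave_val]
  have := congrArg Fin.val hx
  simp at this
  rw [digitPerm_rotPerm_val p n b r _ (by simp [← this, add_comm])]
  simp [Nat.mod_one]

theorem higherFrob_nest {p : ℕ} [NeZero p] (φ : M →+ Tp M p) (i k : ℕ)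
    (h₀ : 1 * (p ^ k * p ^ i) = p ^ (k + i)) (h₁ : p * p ^ i = p ^ (i + 1))
    (h₂ : p * (p ^ k * p ^ i) = p ^ (k + i + 1)) (w : Fin (p ^ k) → Tp M (p ^ i)) :
    higherFrob p φ (k + i) (nest M (interleave (one_mul (p ^ i)) h₀) w) =
      nest M (interleave h₁ h₂) fun b => higherFrob p φ i (w b) := by
  have key : (higherFrob p φ (k + i)).compMultilinearMap
      (nest M (interleave (one_mul (p ^ i)) h₀)) =
      (nest M (interleave h₁ h₂)).compLinearMap fun _ => higherFrob p φ i := by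
    refine MultilinearMap.ext_tprod fun v => ?_
    rw [LinearMap.compMultilinearMap_apply, MultilinearMap.compLinearMap_apply, nest_tprod,
      higherFrob_tprod]
    simp only [higherFrob_tprod]
    rw [← nest_nest (interleave h₁ h₂) (interleave (N := 1) (mul_one p)
      (by rw [mul_one, pow_succ'])) _ (interleave (one_mul (p ^ i)) h₀) fun b b' c => Fin.ext ?_]
    · simp only [Equiv.symm_apply_apply]
    · have hb : b'.val < p ^ i := b'.isLt
      have hN : 0 < p ^ i := pow_pos (NeZero.pos p) i
      simp only [interleave_val, Nat.mod_one, Nat.div_one, zero_add, one_mul, mul_one,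
        Nat.mod_eq_of_lt hb, Nat.div_eq_of_lt hb, mul_zero, add_zero, Nat.add_mul_mod_self_left,
        Nat.add_mul_div_left _ _ hN, pow_add]
  exact congrArg (fun f => f w) key

end HigherFrob

section PowNorm

variable {M : Type*} [AddCommGroup M]

theorem tpowTo_tprod {N B J : ℕ} (v : Fin N → M) (h : N * B = J) :
    tpowTo (PiTensorProduct.tprod ℤ v) B h =
      nest M (interleave (N := 1) (q := N) (mul_one B) (by rw [mul_one, mul_comm, h])) fun j =>
        PiTensorProduct.tprod ℤ fun _ => v j := by
  rw [tpowTo_eq_nest, nest_tprod, nest_tprod]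
  congr 1
  funext x
  have hcomm : ∀ b c, interleave (q := B) (D := 1) (one_mul N)
      (by rw [one_mul, mul_comm, h]) (b, c) =
      interleave (N := 1) (q := N) (mul_one B) (by rw [mul_one, mul_comm, h]) (c, b) := by
    intro b c
    ext
    simp [interleave_val, Nat.mod_eq_of_lt, Nat.div_eq_of_lt, Nat.mod_one]
  obtain ⟨⟨b, c⟩, rfl⟩ := (interleave (q := B) (D := 1) (one_mul N)
    (by rw [one_mul, mul_comm, h])).surjective x
  rw [Equiv.symm_apply_apply, hcomm, Equiv.symm_apply_apply]

theorem sigmaEnd_pow_nest_one {N q J : ℕ} [NeZero N] [NeZero q] [NeZero J]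
    (hJ : 1 * (q * N) = J) (w : Fin q → Tp M N) :
    (sigmaEnd M J ^ N) (nest M (interleave (one_mul N) hJ) w) =
      nest M (interleave (one_mul N) hJ) (cyc id w) := by
  rw [sigmaEnd_pow_nest, sigmaEnd_pow_self]
  rfl

theorem sigmaEnd_pow_tpowTo {N B J : ℕ} [NeZero N] [NeZero B] [NeZero J] (m : Tp M N)
    (h : N * B = J) : (sigmaEnd M J ^ N) (tpowTo m B h) = tpowTo m B h := by
  rw [tpowTo_eq_nest, sigmaEnd_pow_nest_one, (cyc_id_eq_self_iff _).2 fun _ => rfl]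

theorem tpowTo_add_sub_mem {p : ℕ} [NeZero p] (hp : p.Prime) {N J : ℕ} [NeZero N] [NeZero J]
    (h : N * p = J) (x y : Tp M N) :
    tpowTo (x + y) p h - (tpowTo x p h + tpowTo y p h) ∈ transferRange (sigmaEnd M J ^ N) p := by
  have hiter : ∀ w : Fin p → Bool, (cyc id)^[p ^ (0 + 1)] w = w := by
    intro w
    rw [zero_add, pow_one, iterate_cyc]
    rfl
  have hJ : 1 * (p * N) = J := by rw [one_mul, mul_comm, h]
  have key := sum_sub_sum_filter_mem_transferRange hp 0 (cyc id) (sigmaEnd M J ^ N)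
    (fun w : Fin p → Bool => nest M (interleave (one_mul N) hJ) fun b => cond (w b) x y)
    (fun w => by
      rw [sigmaEnd_pow_nest_one]
      exact congrArg _ (comp_cyc (f := fun o => cond o x y) (fun _ => rfl) w).symm) hiter
  have hfix : (Finset.univ.filter fun w : Fin p → Bool => (cyc id)^[p ^ 0] w = w) =
      {fun _ => true, fun _ => false} := by
    ext w
    rw [Finset.mem_filter, pow_zero, Function.iterate_one, cyc_id_eq_self_iff]
    simp only [Finset.mem_univ, true_and, Finset.mem_insert, Finset.mem_singleton, funext_iff]
    cases h0 : w 0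
    · refine ⟨Or.inr, fun h => h.resolve_left fun h => ?_⟩
      simp [h] at h0
    · refine ⟨Or.inl, fun h => h.resolve_right fun h => ?_⟩
      simp [h] at h0
  have hne : (fun _ : Fin p => true) ≠ fun _ => false := fun h => by
    simpa using congrFun h 0
  rw [hfix, Finset.sum_pair hne, zero_add, pow_one,
    ← MultilinearMap.map_sum (nest M (interleave (one_mul N) hJ)) fun _ o => cond o x y] at key
  simpa only [tpowTo_eq_nest, Fintype.sum_bool, cond_true, cond_false] using key

variable {p : ℕ} [NeZero p]

theorem higherFrob_tprod_sub_tpowTo_mem (hp : p.Prime) (φ : ExternalFrobenius p M) (i : ℕ)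
    (h : p ^ i * p = p ^ (i + 1)) (v : Fin (p ^ i) → M) :
    higherFrob p φ.toFun i (PiTensorProduct.tprod ℤ v) -
      tpowTo (PiTensorProduct.tprod ℤ v) p h ∈
        transferRange (sigmaEnd M (p ^ (i + 1)) ^ (p ^ i)) p := by
  choose y hy using fun j => φ.congr_pow (v j)
  have hJ : p * (p ^ i * 1) = p ^ (i + 1) := by rw [mul_one, pow_succ']
  have hrot : ∀ n (w : Fin (p ^ i) → Tp M p), (sigmaEnd M (p ^ (i + 1)) ^ n)
      (nest M (interleave (mul_one p) hJ) w) =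
        nest M (interleave (mul_one p) hJ) ((cyc ⇑(sigmaEnd M p))^[n] w) := by
    intro n
    induction n with
    | zero => intro w; rfl
    | succ n ih =>
      intro w
      have := sigmaEnd_pow_nest (M := M) (mul_one p) hJ w
      rw [pow_one, pow_one] at this
      rw [pow_succ (sigmaEnd M (p ^ (i + 1))) n, Module.End.mul_apply, this, ih]
      rfl
  have hu : ∀ m : M, sigmaEnd M p (PiTensorProduct.tprod ℤ fun _ => m) =
      PiTensorProduct.tprod ℤ fun _ => m := fun m => by
    simpa using sigmaEnd_pow_tprod (M := M) 1 fun _ : Fin p => m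
  have key := map_sub_map_mem_transferRange hp 0 (nest M (interleave (mul_one p) hJ))
    (sigmaEnd M (p ^ (i + 1)) ^ (p ^ i)) (sigmaEnd M p) (fun w => optSucc p ∘ w)
    (fun w => by simp) (fun j => PiTensorProduct.tprod ℤ fun _ => v j) (fun j => φ.toFun (v j)) y
    (fun j => by
      rw [← sub_eq_iff_eq_add', ← hy j, normT]
      simp only [sigmaEnd_pow_iterate])
    (fun w => by
      rw [hrot, iterate_cyc]
      refine congrArg _ (funext fun b => ?_)
      exact (optVal_optSucc (sigmaEnd_pow_self p) (hu _) _ _).symm)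
  rw [zero_add, pow_one] at key
  rwa [higherFrob_tprod, tpowTo_tprod]

theorem higherFrob_sub_tpowTo_mem (hp : p.Prime) (φ : ExternalFrobenius p M) (i : ℕ)
    (h : p ^ i * p = p ^ (i + 1)) (m : Tp M (p ^ i)) :
    higherFrob p φ.toFun i m - tpowTo m p h ∈
      transferRange (sigmaEnd M (p ^ (i + 1)) ^ (p ^ i)) p := by
  induction m using PiTensorProduct.induction_on with
  | smul_tprod r v =>
    have hr : r • PiTensorProduct.tprod ℤ v =
        PiTensorProduct.tprod ℤ (Function.update v 0 (r • v 0)) := by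
      rw [MultilinearMap.map_update_smul, Function.update_eq_self]
    rw [hr]
    exact higherFrob_tprod_sub_tpowTo_mem hp φ i h _
  | add x y hx hy =>
    have := sub_mem (add_mem hx hy) (tpowTo_add_sub_mem hp h x y)
    convert this using 1
    rw [map_add]
    abel

end PowNorm
/-- let `p` be a prime and `M` an abelian group with an external Frobenius `φ`.
Then for all `i, k ≥ 0` and every `m ∈ M^{⊗p^i}`, the element
`φ_{k+i}(m^{⊗p^k}) − m^{⊗p^{k+1}}` of `M^{⊗p^{k+i+1}}` lies in the image of the transfer
`tr_e^{C_{p^{k+1}}} = Σ_{s=0}^{p^{k+1}-1} σ_{k+i+1}^{s·p^i}`, the norm of the subgroup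
`C_{p^{k+1}} ⊆ C_{p^{k+i+1}}` generated by `σ_{k+i+1}^{p^i}`. -/
theorem statement9 (p : ℕ) [NeZero p] (hp : p.Prime) (M : Type*) [AddCommGroup M]
    (φ : ExternalFrobenius p M) (i k : ℕ) (m : Tp M (p ^ i)) :
    higherFrob p φ.toFun (k + i) (tpowTo m (p ^ k) (show p ^ i * p ^ k = p ^ (k + i) by ring))
        - tpowTo m (p ^ (k + 1)) (show p ^ i * p ^ (k + 1) = p ^ (k + i + 1) by ring)
      ∈ Set.range (fun y : Tp M (p ^ (k + i + 1)) =>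
          ∑ s ∈ Finset.range (p ^ (k + 1)), (⇑(sigmaT M (p ^ (k + i + 1))))^[s * p ^ i] y) := by
  have h₀ : 1 * (p ^ k * p ^ i) = p ^ (k + i) := by ring
  have h₁ : p * p ^ i = p ^ (i + 1) := by ring
  have h₂ : p * (p ^ k * p ^ i) = p ^ (k + i + 1) := by ring
  have h₃ : p ^ i * p = p ^ (i + 1) := by ring
  have h₄ : 1 * (p ^ (k + 1) * p ^ i) = p ^ (k + i + 1) := by ring
  have hpow : tpowTo m (p ^ (k + 1)) (show p ^ i * p ^ (k + 1) = p ^ (k + i + 1) by ring) =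
      nest M (interleave h₁ h₂) fun _ : Fin (p ^ k) => tpowTo m p h₃ := by
    have hg : p * (p ^ k * 1) = p ^ (k + 1) := by ring
    simp only [tpowTo_eq_nest]
    refine (nest_nest _ _ _ (interleave (mul_one p) hg) (fun b d c => Fin.ext ?_) fun _ => m).symm
    have hN : 0 < p ^ i := pow_pos hp.pos i
    simp only [interleave_val, Nat.mod_one, Nat.div_one, zero_add, one_mul, mul_one,
      Nat.mod_eq_of_lt c.isLt, Nat.div_eq_of_lt c.isLt, mul_zero, add_zero,
      Nat.add_mul_mod_self_left, Nat.add_mul_div_left _ _ hN]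
    ring
  have hρ : (sigmaEnd M (p ^ (i + 1)) ^ (p ^ i)) ^ p = 1 := by
    rw [← pow_mul, h₃, sigmaEnd_pow_self]
  obtain ⟨y, hy⟩ := mem_transferRange.1 (higherFrob_sub_tpowTo_mem hp φ i h₃ m)
  have key := map_sub_map_mem_transferRange hp k (nest M (interleave h₁ h₂))
    (sigmaEnd M (p ^ (k + i + 1)) ^ (p ^ i)) (sigmaEnd M (p ^ (i + 1)) ^ (p ^ i))
    (cyc (optSucc p)) (iterate_cyc _) (fun _ => tpowTo m p h₃)
    (fun _ => higherFrob p φ.toFun i m) (fun _ => y) (fun _ => by rw [hy, add_sub_cancel])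
    (fun w => by
      rw [sigmaEnd_pow_nest]
      exact congrArg _ (comp_cyc
        (optVal_optSucc hρ (sigmaEnd_pow_tpowTo m h₃) y) w).symm)
  rw [hpow, tpowTo_eq_nest, higherFrob_nest φ.toFun i k h₀ h₁ h₂]
  obtain ⟨z, hz⟩ := mem_transferRange.1 key
  refine ⟨z, Eq.trans (Finset.sum_congr rfl fun s _ => ?_) hz⟩
  rw [← pow_mul, sigmaEnd_pow_iterate, mul_comm]
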